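/- Let p ∈ 𝔽₂[X] be an irreducible polynomial of degree n ≥ 2. Then there exist exactly two polynomials q ∈ 𝔽₂[X] with deg q < n satisfying the congruence q² + (X² + X)·p'·q + 1 ≡ 0 (mod p), where p' is the formal derivative of p; moreover, for each of these two solutions q, Euclid's algorithm applied to p and q (remainder sequence r_0 = p, r_1 = q, r_{i+1} = r_{i-1} mod r_i) results in exactly n quotients each of degree one. -/

import Mathlib

open Polynomial

/-- Remainder sequence of Euclid's algorithm applied to `(p, q)`. -/
noncomputable def euclidRem (p q : Polynomial (ZMod 2)) : ℕ → Polynomial (ZMod 2)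
  | 0 => p
  | 1 => q
  | (i + 2) => euclidRem p q i % euclidRem p q (i + 1)

/-- The affine part of the invariant. -/
noncomputable def LL (p q : Polynomial (ZMod 2)) : Polynomial (ZMod 2) :=
  q ^ 2 + (X ^ 2 + X) * derivative (p * q) + p * q

lemma two_zero : (2 : Polynomial (ZMod 2)) = 0 := CharTwo.two_eq_zero

lemma dd_zero (f : Polynomial (ZMod 2)) : derivative (derivative f) = 0 := by
  ext k
  simp only [coeff_derivative, coeff_zero, mul_assoc]
  have : ∀ x y : ZMod 2, y * ((x + 1 + 1) * (x + 1)) = 0 := by decide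
  have h := this (k : ZMod 2) (f.coeff (k + 1 + 1))
  push_cast
  exact h

lemma LL_deriv (p q : Polynomial (ZMod 2)) : derivative (LL p q) = 0 := by
  have h := dd_zero (p * q)
  have h2 := two_zero
  unfold LL
  rw [derivative_add, derivative_add, derivative_mul (f := X ^ 2 + X), h]
  generalize derivative (p * q) = w
  simp only [derivative_pow, derivative_add, derivative_X]
  have hC : (C 2 : Polynomial (ZMod 2)) = 2 := rfl
  simp [hC]
  linear_combination (q * derivative q + X * w + w) * h2

lemma LL_sq (p q : Polynomial (ZMod 2)) : ∃ m, LL p q = m ^ 2 := by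
  refine ⟨contract 2 (LL p q), ?_⟩
  rw [← ZMod.expand_card]
  exact (expand_contract 2 (LL_deriv p q) (by norm_num)).symm

lemma LL_coeff (n : ℕ) (hn : 1 ≤ n) (p q : Polynomial (ZMod 2)) (hp : p.natDegree = n)
    (hq : q.degree < (n : ℕ)) :
    (LL p q).natDegree ≤ 2 * n ∧ (LL p q).coeff (2 * n) = q.coeff (n - 1) := by
  obtain ⟨k, rfl⟩ : ∃ k, n = k + 1 := ⟨n - 1, by omega⟩
  have hq' : q.natDegree ≤ k := by
    rw [natDegree_le_iff_degree_le, ← Order.lt_succ_iff]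
    exact_mod_cast hq
  have hpq : (p * q).natDegree ≤ 2 * k + 1 :=
    natDegree_mul_le.trans (by omega)
  have hd : (derivative (p * q)).natDegree ≤ 2 * k :=
    (natDegree_derivative_le _).trans (by omega)
  have hX : (X ^ 2 + X : Polynomial (ZMod 2)).natDegree ≤ 2 := by compute_degree
  have h1 : (q ^ 2).natDegree ≤ 2 * k := natDegree_pow_le.trans (by omega)
  have h3 : ((X ^ 2 + X) * derivative (p * q)).natDegree ≤ 2 + 2 * k :=
    natDegree_mul_le.trans (by omega)
  constructor
  · unfold LL
    refine natDegree_add_le_of_degree_le (natDegree_add_le_of_degree_le ?_ ?_) ?_ <;> omega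
  · unfold LL
    have hlc : p.coeff (k + 1) = 1 := by
      have hne : p.coeff (k + 1) ≠ 0 := by
        rw [← hp, coeff_natDegree, Ne, leadingCoeff_eq_zero]
        rintro rfl
        simp at hp
      revert hne
      generalize p.coeff (k + 1) = y
      revert y
      decide
    have hc : (p * q).coeff (k + 1 + k) = p.coeff (k + 1) * q.coeff k :=
      coeff_mul_add_eq_of_natDegree_le hp.le hq'
    have hXc : ((X ^ 2 + X) * derivative (p * q)).coeff (2 + 2 * k)
        = (X ^ 2 + X : Polynomial (ZMod 2)).coeff 2 * (derivative (p * q)).coeff (2 * k) :=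
      coeff_mul_add_eq_of_natDegree_le hX hd
    have e : 2 * (k + 1) = 2 + 2 * k := by ring
    rw [coeff_add, coeff_add, e, hXc, coeff_eq_zero_of_natDegree_lt (by omega),
      coeff_eq_zero_of_natDegree_lt (p := p * q) (by omega), coeff_derivative,
      show 2 * k + 1 = k + 1 + k by ring, hc, hlc]
    have : ((2 * k : ℕ) : ZMod 2) = 0 := by
      push_cast
      rw [show (2 : ZMod 2) = 0 from rfl, zero_mul]
    rw [this]
    simp [coeff_X]

lemma LL_step (p q a : Polynomial (ZMod 2)) (ha : a = X ∨ a = X + 1) :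
    LL (q * a + p) q + (q * a + p) ^ 2 = LL q p + q ^ 2 := by
  have h2 := two_zero
  have hda : derivative a = 1 := by rcases ha with rfl | rfl <;> simp
  have haa : a ^ 2 + a = X ^ 2 + X := by
    rcases ha with rfl | rfl
    · rfl
    · linear_combination (X + 1) * h2
  unfold LL
  simp only [derivative_mul, derivative_add, hda]
  linear_combination q ^ 2 * haa + (q * a * p + (X ^ 2 + X) * q ^ 2
    + (X ^ 2 + X) * derivative q * q * a) * h2

lemma deg_one (a : Polynomial (ZMod 2)) (h : a.degree = 1) : a = X ∨ a = X + 1 := by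
  have h1 := eq_X_add_C_of_degree_le_one h.le
  have hne : a.coeff 1 ≠ 0 := by
    intro h0
    have := coeff_ne_zero_of_eq_degree (n := 1) (by simpa using h)
    exact this h0
  have key : ∀ y : ZMod 2, y ≠ 0 → y = 1 := by decide
  have key2 : ∀ y : ZMod 2, y = 0 ∨ y = 1 := by decide
  rw [key _ hne] at h1
  rcases key2 (a.coeff 0) with h0 | h0 <;> rw [h0] at h1 <;> simp at h1
  · exact Or.inl h1
  · exact Or.inr h1

lemma euclid_shift (p q : Polynomial (ZMod 2)) (i : ℕ) :
    euclidRem p q (i + 1) = euclidRem q (p % q) i := by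
  induction i using Nat.twoStepInduction with
  | zero => simp [euclidRem]
  | one => simp [euclidRem]
  | more i h1 h2 =>
    rw [show euclidRem p q (i + 2 + 1) = euclidRem p q (i + 1) % euclidRem p q (i + 1 + 1) from rfl,
      h1, h2]
    rfl

lemma euclid_main (n : ℕ) : ∀ (p q : Polynomial (ZMod 2)), p.degree = (n : ℕ) →
    q.degree < (n : ℕ) → LL p q + p ^ 2 = 1 →
    (∀ i < n, (euclidRem p q i / euclidRem p q (i + 1)).degree = 1) ∧
      (∀ i ≤ n, (euclidRem p q i).degree = (n - i : ℕ)) := by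
  induction n with
  | zero =>
    intro p q hp hq hE
    refine ⟨by simp, ?_⟩
    intro i hi
    obtain rfl : i = 0 := by omega
    simpa [euclidRem] using hp
  | succ k ih =>
    intro p q hp hq hE
    have hpn : p.natDegree = k + 1 := natDegree_eq_of_degree_eq_some hp
    obtain ⟨-, hc⟩ := LL_coeff (k + 1) (by omega) p q hpn hq
    have hp2 : (p ^ 2).coeff (2 * (k + 1)) = 1 := by
      have hm : (p ^ 2).natDegree = 2 * (k + 1) := by rw [natDegree_pow, hpn]
      have hne : (p ^ 2).coeff (2 * (k + 1)) ≠ 0 := by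
        rw [← hm, coeff_natDegree, Ne, leadingCoeff_eq_zero]
        intro h
        rw [h] at hm
        simp at hm
      revert hne
      generalize (p ^ 2).coeff (2 * (k + 1)) = y
      revert y
      decide
    have hqc : q.coeff k ≠ 0 := by
      intro h0
      have := congrArg (fun f => coeff f (2 * (k + 1))) hE
      simp only [coeff_add, hc, hp2] at this
      rw [show k + 1 - 1 = k from rfl, h0, coeff_one] at this
      simp at this
    have hqd : q.degree = (k : ℕ) := by
      refine le_antisymm ?_ (le_degree_of_ne_zero hqc)
      rw [← Order.lt_succ_iff]
      exact_mod_cast hq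
    have hq0 : q ≠ 0 := by
      rintro rfl
      simp at hqc
    have hle : q.degree ≤ p.degree := by
      rw [hp, hqd]
      exact_mod_cast Nat.le_succ k
    have hdiv : (p / q).degree = 1 := by
      have hh := degree_add_div hq0 hle
      have hdq0 : p / q ≠ 0 := by
        intro h
        rw [h, hqd, hp, degree_zero, WithBot.add_bot] at hh
        exact WithBot.bot_ne_coe hh
      rw [degree_eq_natDegree hdq0, hqd, hp] at hh
      rw [degree_eq_natDegree hdq0]
      norm_cast at hh ⊢
      omega
    have hr : (p % q).degree < (k : ℕ) := hqd ▸ EuclideanDomain.mod_lt p hq0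
    have hE' : LL q (p % q) + q ^ 2 = 1 := by
      rw [← LL_step (p % q) q (p / q) (deg_one _ hdiv), EuclideanDomain.div_add_mod]
      exact hE
    obtain ⟨i1, i2⟩ := ih q (p % q) hqd hr hE'
    constructor
    · intro i hi
      rcases i with _ | i
      · simpa [euclidRem] using hdiv
      · rw [euclid_shift, euclid_shift]
        exact i1 i (by omega)
    · intro i hi
      rcases i with _ | i
      · simpa [euclidRem] using hp
      · rw [euclid_shift, i2 i (by omega)]
        congr 1
        omega

lemma eval_one_of_irred (p : Polynomial (ZMod 2)) (hp : Irreducible p) (hn : 2 ≤ p.natDegree)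
    (x : ZMod 2) : p.eval x = 1 := by
  have h : ¬ p.IsRoot x := hp.not_isRoot_of_natDegree_ne_one (by omega)
  rw [IsRoot.def] at h
  revert h
  generalize p.eval x = y
  revert y
  decide

lemma eval_LL (p q : Polynomial (ZMod 2)) (hp : Irreducible p) (hn : 2 ≤ p.natDegree)
    (x : ZMod 2) : (LL p q).eval x = 0 := by
  unfold LL
  simp only [eval_add, eval_mul, eval_pow, eval_X, eval_one_of_irred p hp hn x]
  have key : ∀ x y z : ZMod 2, y ^ 2 + (x ^ 2 + x) * z + 1 * y = 0 := by decide
  exact key _ _ _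

lemma LL_add (p q r : Polynomial (ZMod 2)) : LL p (q + r) = LL p q + LL p r := by
  unfold LL
  rw [mul_add, derivative_add]
  linear_combination q * r * two_zero

lemma LL_root (n : ℕ) (hn : 2 ≤ n) (p q : Polynomial (ZMod 2)) (hp : Irreducible p)
    (hpn : p.natDegree = n) (hq : q.degree < (n : ℕ)) :
    ∃ m, LL p q = m ^ 2 ∧ m.natDegree ≤ n ∧ ∀ x, m.eval x = 0 := by
  obtain ⟨m, hm⟩ := LL_sq p q
  refine ⟨m, hm, ?_, ?_⟩
  · have := (LL_coeff n (by omega) p q hpn hq).1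
    rw [hm, natDegree_pow] at this
    omega
  · intro x
    have := eval_LL p q hp (by omega) x
    rw [hm, eval_pow] at this
    exact pow_eq_zero_iff (two_ne_zero) |>.1 this

lemma factor (n : ℕ) (hn : 2 ≤ n) (m : Polynomial (ZMod 2)) (hm : m.natDegree ≤ n)
    (h : ∀ x, m.eval x = 0) : ∃ g : degreeLT (ZMod 2) (n - 1), m = (X ^ 2 + X) * (g : Polynomial (ZMod 2)) := by
  have h0 : X ∣ m := by
    rw [X_dvd_iff, coeff_zero_eq_eval_zero]; exact h 0
  obtain ⟨a, rfl⟩ := h0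
  have h1 : (X - C 1) ∣ a := by
    rw [dvd_iff_isRoot, IsRoot.def]
    simpa using h 1
  obtain ⟨g, rfl⟩ := h1
  have e : (X * ((X - C 1) * g) : Polynomial (ZMod 2)) = (X ^ 2 + X) * g := by
    rw [C_1]
    linear_combination (- X * g) * two_zero
  refine ⟨⟨g, ?_⟩, e⟩
  rw [mem_degreeLT]
  by_cases hg : g = 0
  · rw [hg, degree_zero]; exact WithBot.bot_lt_coe _
  · rw [degree_eq_natDegree hg]
    have : (X * ((X - C 1) * g) : Polynomial (ZMod 2)).natDegree = 1 + (1 + g.natDegree) := by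
      rw [natDegree_mul X_ne_zero (mul_ne_zero (X_sub_C_ne_zero 1) hg),
        natDegree_mul (X_sub_C_ne_zero 1) hg, natDegree_X, natDegree_X_sub_C]
    rw [this] at hm
    norm_cast
    omega

lemma congr_iff (n : ℕ) (hn : 2 ≤ n) (p q : Polynomial (ZMod 2)) (hp : Irreducible p)
    (hpn : p.natDegree = n) (hq : q.degree < (n : ℕ)) :
    p ∣ q ^ 2 + (X ^ 2 + X) * derivative p * q + 1 ↔ LL p q + p ^ 2 = 1 := by
  have e : q ^ 2 + (X ^ 2 + X) * derivative p * q + 1 =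
      (LL p q + p ^ 2 + 1) + p * (- (X ^ 2 + X) * derivative q - q - p) := by
    unfold LL
    rw [derivative_mul]
    ring
  rw [e, dvd_add_left (dvd_mul_right _ _)]
  constructor
  · intro h
    obtain ⟨m, hm, hmd, hm0⟩ := LL_root n hn p q hp hpn hq
    have e2 : LL p q + p ^ 2 + 1 = (m + p + 1) ^ 2 := by
      rw [hm]
      linear_combination (- m * p - m - p) * two_zero
    rw [e2] at h
    obtain ⟨k, hk⟩ := hp.prime.dvd_of_dvd_pow h
    have hk0 : k = 0 := by
      by_contra hk0
      have hd : (m + p + 1).natDegree ≤ n := by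
        refine natDegree_add_le_of_degree_le (natDegree_add_le_of_degree_le hmd hpn.le) ?_
        simp
      rw [hk, natDegree_mul hp.ne_zero hk0] at hd
      have hk1 : k.natDegree = 0 := by omega
      obtain ⟨c, rfl⟩ := natDegree_eq_zero.1 hk1
      have := congrArg (eval 0) hk
      simp only [eval_add, eval_mul, eval_one, eval_C, hm0,
        eval_one_of_irred p hp (by omega)] at this
      apply hk0
      have h11 : (0 + 1 + 1 : ZMod 2) = 0 := rfl
      rw [h11, one_mul] at this
      rw [← this, C_0]
    rw [hk, hk0] at e2
    linear_combination e2 - two_zero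
  · intro h
    rw [h]
    have : (1 + 1 : Polynomial (ZMod 2)) = 0 := by linear_combination two_zero
    rw [this]
    exact dvd_zero _

/-- The map `q ↦ LL p q` on polynomials of degree `< n`. -/
noncomputable def phi (p : Polynomial (ZMod 2)) (n : ℕ) :
    degreeLT (ZMod 2) n →ₗ[ZMod 2] Polynomial (ZMod 2) :=
  AddMonoidHom.toZModLinearMap 2
    { toFun := fun q => LL p q
      map_zero' := by simp [LL]
      map_add' := fun q r => LL_add p q r }

/-- The map `g ↦ ((X² + X) g)²` on polynomials of degree `< n`. -/
noncomputable def psi (n : ℕ) :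
    degreeLT (ZMod 2) n →ₗ[ZMod 2] Polynomial (ZMod 2) :=
  AddMonoidHom.toZModLinearMap 2
    { toFun := fun g => ((X ^ 2 + X) * (g : Polynomial (ZMod 2))) ^ 2
      map_zero' := by simp
      map_add' := fun q r => by
        simp only [Submodule.coe_add]
        linear_combination ((X ^ 2 + X) ^ 2 * (q : Polynomial (ZMod 2)) * r) * two_zero }

lemma finrank_dlt (n : ℕ) : Module.finrank (ZMod 2) (degreeLT (ZMod 2) n) = n := by
  rw [(degreeLTEquiv (ZMod 2) n).finrank_eq]; simp

instance finite_dlt (n : ℕ) : Module.Finite (ZMod 2) (degreeLT (ZMod 2) n) :=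
  Module.Finite.equiv (degreeLTEquiv (ZMod 2) n).symm

lemma XX_ne : (X ^ 2 + X : Polynomial (ZMod 2)) ≠ 0 := by
  intro h
  have := congrArg (fun f => coeff f 1) h
  simp [coeff_X_pow] at this

lemma eq_of_dvd (n : ℕ) (p q r : Polynomial (ZMod 2)) (hp : p.natDegree = n) (hp0 : p ≠ 0)
    (hq : q.degree < (n : ℕ)) (hr : r.degree < (n : ℕ)) (h : p ∣ q - r) : q = r := by
  rw [← sub_eq_zero]
  refine eq_zero_of_dvd_of_degree_lt h ?_
  rw [degree_eq_natDegree hp0, hp]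
  exact lt_of_le_of_lt (degree_sub_le _ _) (max_lt hq hr)

lemma not_dvd_c (p : Polynomial (ZMod 2)) (hp : Irreducible p) (hn : 2 ≤ p.natDegree) :
    ¬ p ∣ (X ^ 2 + X) * derivative p := by
  intro h
  rw [show (X ^ 2 + X : Polynomial (ZMod 2)) = X * (X + C 1) by rw [C_1]; ring] at h
  rcases hp.prime.dvd_or_dvd h with h | h
  · rcases hp.prime.dvd_or_dvd h with h | h
    · have := natDegree_le_of_dvd h X_ne_zero
      rw [natDegree_X] at this
      omega
    · have := natDegree_le_of_dvd h (X_add_C_ne_zero 1)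
      rw [natDegree_X_add_C] at this
      omega
  · have hs : p.Separable := PerfectField.separable_of_irreducible hp
    exact hp.not_isUnit (hs.isUnit_of_dvd' dvd_rfl h)

lemma my_dvd_sub_mod (a b : Polynomial (ZMod 2)) : b ∣ a - a % b :=
  ⟨a / b, by linear_combination - EuclideanDomain.div_add_mod a b⟩

lemma exists_sol (n : ℕ) (hn : 2 ≤ n) (p : Polynomial (ZMod 2)) (hp : Irreducible p)
    (hpn : p.natDegree = n) : ∃ q : Polynomial (ZMod 2), q.degree < (n : ℕ) ∧
      LL p q + p ^ 2 = 1 := by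
  have hle : LinearMap.range (phi p n) ≤ LinearMap.range (psi (n - 1)) := by
    rintro _ ⟨q, rfl⟩
    obtain ⟨m, hm, hmd, hm0⟩ := LL_root n hn p q hp hpn (mem_degreeLT.1 q.2)
    obtain ⟨g, hg⟩ := factor n hn m hmd hm0
    refine ⟨g, ?_⟩
    change ((X ^ 2 + X) * (g : Polynomial (ZMod 2))) ^ 2 = LL p q
    rw [hm, ← hg]
  have hmodlt : (((X ^ 2 + X) * derivative p) % p).degree < ((n : ℕ) : WithBot ℕ) := by
    rw [← hpn, ← degree_eq_natDegree hp.ne_zero]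
    exact EuclideanDomain.mod_lt _ hp.ne_zero
  let q0 : degreeLT (ZMod 2) n := ⟨((X ^ 2 + X) * derivative p) % p, mem_degreeLT.2 hmodlt⟩
  have hker : LinearMap.ker (phi p n) ≤ Submodule.span (ZMod 2) {q0} := by
    intro q hq
    have hq' : LL p q = 0 := hq
    have hd : p ∣ (q : Polynomial (ZMod 2)) * ((q : Polynomial (ZMod 2)) - ((X ^ 2 + X) * derivative p)) := by
      refine ⟨- ((X ^ 2 + X) * derivative (q : Polynomial (ZMod 2))) - (q : Polynomial (ZMod 2)), ?_⟩
      unfold LL at hq'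
      rw [derivative_mul] at hq'
      linear_combination hq' - (X ^ 2 + X) * derivative p * (q : Polynomial (ZMod 2)) * two_zero
    rcases hp.prime.dvd_or_dvd hd with h | h
    · have : q = 0 := by
        apply Subtype.ext
        refine eq_of_dvd n p _ _ hpn hp.ne_zero (mem_degreeLT.1 q.2) (mem_degreeLT.1 (0 : degreeLT (ZMod 2) n).2) ?_
        simpa using h
      rw [this]
      exact Submodule.zero_mem _
    · have : q = q0 := by
        apply Subtype.ext
        refine eq_of_dvd n p _ _ hpn hp.ne_zero (mem_degreeLT.1 q.2) (mem_degreeLT.1 q0.2) ?_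
        have h2 := dvd_add h (my_dvd_sub_mod ((X ^ 2 + X) * derivative p) p)
        rwa [sub_add_sub_cancel] at h2
      rw [this]
      exact Submodule.mem_span_singleton_self _
  have hk1 : Module.finrank (ZMod 2) (LinearMap.ker (phi p n)) ≤ 1 :=
    (Submodule.finrank_mono hker).trans (by simpa using finrank_span_le_card (R := ZMod 2) ({q0} : Set (degreeLT (ZMod 2) n)))
  have hrn := LinearMap.finrank_range_add_finrank_ker (phi p n)
  rw [finrank_dlt] at hrn
  have hr2 : Module.finrank (ZMod 2) (LinearMap.range (psi (n - 1))) ≤ n - 1 := by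
    have := LinearMap.finrank_range_le (psi (n - 1))
    rwa [finrank_dlt] at this
  have heq := Submodule.eq_of_le_of_finrank_le hle (by omega)
  have hpe : ∀ x, (p + 1).eval x = 0 := by
    intro x
    rw [eval_add, eval_one_of_irred p hp (by omega), eval_one]
    rfl
  obtain ⟨g, hg⟩ := factor n hn (p + 1)
    (natDegree_add_le_of_degree_le hpn.le (by simp)) hpe
  have hmem : psi (n - 1) g ∈ LinearMap.range (phi p n) := by
    rw [heq]; exact ⟨g, rfl⟩
  obtain ⟨q, hq⟩ := hmem
  refine ⟨q, mem_degreeLT.1 q.2, ?_⟩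
  have hq2 : LL p q = ((X ^ 2 + X) * (g : Polynomial (ZMod 2))) ^ 2 := hq
  rw [hq2, ← hg]
  linear_combination (p ^ 2 + p) * two_zero

lemma count_two (n : ℕ) (hn : 2 ≤ n)
    (p : Polynomial (ZMod 2)) (hp : Irreducible p) (hpdeg : p.natDegree = n) :
    ({q : Polynomial (ZMod 2) | q.degree < (n : ℕ) ∧
        p ∣ q ^ 2 + (X ^ 2 + X) * derivative p * q + 1}).ncard = 2 := by
  obtain ⟨q1, hq1, hE⟩ := exists_sol n hn p hp hpdeg
  have hs := (congr_iff n hn p q1 hp hpdeg hq1).2 hE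
  have hc := not_dvd_c p hp (by omega)
  generalize hcdef : (X ^ 2 + X) * derivative p = c at *
  have hmodlt : (c % p).degree < (n : ℕ) := by
    rw [← hpdeg, ← degree_eq_natDegree hp.ne_zero]
    exact EuclideanDomain.mod_lt _ hp.ne_zero
  have hmod : p ∣ c - c % p := my_dvd_sub_mod c p
  have hne : c % p ≠ 0 := fun h => hc (EuclideanDomain.mod_eq_zero.1 h)
  have hlt : (q1 + c % p).degree < (n : ℕ) :=
    lt_of_le_of_lt (degree_add_le _ _) (max_lt hq1 hmodlt)
  have : {q : Polynomial (ZMod 2) | q.degree < (n : ℕ) ∧ p ∣ q ^ 2 + c * q + 1}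
      = {q1, q1 + c % p} := by
    ext q
    simp only [Set.mem_ofPred_eq, Set.mem_insert_iff, Set.mem_singleton_iff]
    constructor
    · rintro ⟨hq, hd⟩
      have h3 : p ∣ (q - q1) * (q - (q1 + c)) := by
        have h4 := dvd_sub hd hs
        have e : q ^ 2 + c * q + 1 - (q1 ^ 2 + c * q1 + 1) = (q - q1) * (q - (q1 + c)) := by
          linear_combination (q * c - q1 * c + q * q1 - q1 ^ 2) * two_zero
        rwa [e] at h4
      rcases hp.prime.dvd_or_dvd h3 with h | h
      · exact Or.inl (eq_of_dvd n p _ _ hpdeg hp.ne_zero hq hq1 h)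
      · refine Or.inr (eq_of_dvd n p _ _ hpdeg hp.ne_zero hq hlt ?_)
        have h5 := dvd_add h hmod
        have e : q - (q1 + c) + (c - c % p) = q - (q1 + c % p) := by ring
        rwa [e] at h5
    · rintro (rfl | rfl)
      · exact ⟨hq1, hs⟩
      · refine ⟨hlt, ?_⟩
        have h6 := dvd_add hs (Dvd.dvd.mul_right hmod (c % p))
        have e : (q1 + c % p) ^ 2 + c * (q1 + c % p) + 1
            = q1 ^ 2 + c * q1 + 1 + (c - c % p) * (c % p) := by
          linear_combination (q1 * (c % p) + (c % p) ^ 2) * two_zero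
        rwa [e]
  rw [this, Set.ncard_pair]
  intro h
  exact hne (by simpa using h.symm)

/-- For an irreducible `p ∈ 𝔽₂[X]` of degree `n ≥ 2`, the quadratic congruence
`q² + (X² + X)·p'·q + 1 ≡ 0 (mod p)` has exactly two solutions `q` of degree
`< n`, and each solution makes Euclid's algorithm on `(p, q)` produce exactly
`n` quotients of degree one. -/
theorem irreducible_quadratic_congruence_two_solutions (n : ℕ) (hn : 2 ≤ n)
    (p : Polynomial (ZMod 2)) (hp : Irreducible p) (hpdeg : p.natDegree = n) :
    ({q : Polynomial (ZMod 2) | q.degree < (n : ℕ) ∧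
        p ∣ q ^ 2 + (X ^ 2 + X) * derivative p * q + 1}).ncard = 2 ∧
    (∀ q : Polynomial (ZMod 2), q.degree < (n : ℕ) →
      p ∣ q ^ 2 + (X ^ 2 + X) * derivative p * q + 1 →
      (∀ i < n, (euclidRem p q i / euclidRem p q (i + 1)).degree = 1) ∧
      (∀ i ≤ n, (euclidRem p q i).degree = (n - i : ℕ))) := by
  refine ⟨count_two n hn p hp hpdeg, fun q hq hd => ?_⟩
  refine euclid_main n p q ?_ hq ((congr_iff n hn p q hp hpdeg hq).1 hd)
  rw [degree_eq_natDegree hp.ne_zero, hpdeg]
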